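/- Let k be a field of characteristic p ≥ 0 and 1 ≤ m ≤ n integers. If p = 0 or p > m+n−2, then there is an isomorphism of k[X]-modules M_m ⊗_k M_n ≅ ∏_{i=0}^{m−1} M_{m+n−1−2i}, where X acts on the tensor product as X⊗1 + 1⊗X. (Equivalently, the Jordan normal form of T_{m,n} consists of exactly one block of each of the sizes m+n−1, m+n−3, …, n−m+1.) -/

import Mathlib

open Polynomial TensorProduct

/-- `M_n := k[X]/(X^n)`, with the convention `M_0 = 0`. -/
abbrev Mq (k : Type) [Field k] (n : ℕ) : Type :=
  Polynomial k ⧸ Ideal.span {(Polynomial.X : Polynomial k) ^ n}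

/-- Multiplication by `X` on `M_n`, as a `k`-linear endomorphism. -/
noncomputable def mulX (k : Type) [Field k] (n : ℕ) : Module.End k (Mq k n) :=
  (LinearMap.lsmul (Polynomial k) (Mq k n) (Polynomial.X : Polynomial k)).restrictScalars k

/-- The endomorphism `X ⊗ 1 + 1 ⊗ X` of `M_m ⊗_k M_n`. -/
noncomputable def tensorX (k : Type) [Field k] (m n : ℕ) :
    Module.End k (TensorProduct k (Mq k m) (Mq k n)) :=
  TensorProduct.map (mulX k m) LinearMap.id + TensorProduct.map LinearMap.id (mulX k n)

lemma descFactorial_cast_ne_zero {k : Type*} [Field k] {p : ℕ} [CharP k p] {N i j : ℕ}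
    (hp : p = 0 ∨ N < p) (hij : i ≤ j) (hj : j ≤ N) : (j.descFactorial i : k) ≠ 0 := by
  rw [Ne, CharP.cast_eq_zero_iff k p]
  intro h
  rcases hp with rfl | hp
  · rw [zero_dvd_iff, Nat.descFactorial_eq_zero_iff_lt] at h
    omega
  · have hprime : p.Prime := (CharP.char_is_prime_or_zero k p).resolve_right (by omega)
    have h' := h.trans (Dvd.intro_left _ (Nat.factorial_mul_descFactorial hij))
    rw [hprime.dvd_factorial] at h'
    omega

/-- If `f` has small degree, `X ^ m` divides `f`, `(1 - X) ^ n` divides `g` and `f + g` has degree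
less than `i`, then `f` has degree less than `i`. -/
lemma coeff_eq_zero_of_add_coeff_eq_zero {k : Type*} [Field k] {p : ℕ} [CharP k p]
    {m n i : ℕ} (him : i < m) (hmn : m ≤ n) (hp : p = 0 ∨ m + n - 2 < p) {f g : k[X]}
    (hf : X ^ m ∣ f) (hg : (1 - X) ^ n ∣ g) (hfd : f.natDegree ≤ m + n - 1 - i)
    (hfg : ∀ j, i ≤ j → (f + g).coeff j = 0) {j : ℕ} (hj : i ≤ j) : f.coeff j = 0 := by
  have hsum : derivative^[i] (f + g) = 0 := by
    ext j
    rw [coeff_iterate_derivative, hfg _ (by omega)]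
    simp
  have hX := pow_sub_dvd_iterate_derivative_of_pow_dvd i hf
  have hY := pow_sub_dvd_iterate_derivative_of_pow_dvd i hg
  rw [iterate_map_add, add_eq_zero_iff_eq_neg'] at hsum
  rw [hsum, dvd_neg] at hY
  have hcop : IsCoprime ((X : k[X]) ^ (m - i)) ((1 - X) ^ (n - i)) :=
    IsCoprime.pow ⟨1, 1, by ring⟩
  have hdvd := hcop.mul_dvd hX hY
  have hzero : derivative^[i] f = 0 := by
    by_contra hne
    have h1 := natDegree_le_of_dvd hdvd hne
    have h2 := natDegree_iterate_derivative f i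
    have hdeg : (1 - X : k[X]).natDegree = 1 := by
      rw [← neg_sub, natDegree_neg]
      exact natDegree_X_sub_C (1 : k)
    have hne' : (1 - X : k[X]) ≠ 0 := by
      intro h
      simp [h] at hdeg
    rw [natDegree_mul (pow_ne_zero _ X_ne_zero) (pow_ne_zero _ hne'), natDegree_pow,
      natDegree_pow, hdeg, natDegree_X] at h1
    omega
  by_cases hjd : f.natDegree < j
  · exact coeff_eq_zero_of_natDegree_lt hjd
  have h := congrArg (fun q => q.coeff (j - i)) hzero
  simp only [coeff_iterate_derivative, coeff_zero, nsmul_eq_mul, Nat.sub_add_cancel hj] at h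
  refine (mul_eq_zero.1 h).resolve_left ?_
  rcases Nat.eq_zero_or_pos i with rfl | hi
  · simp
  · exact descFactorial_cast_ne_zero hp hj (by omega)

/-- Hermite–Padé type interpolation: some combination of `X ^ m` and `(1 - X) ^ n` with
coefficients of small degree is monic of degree `i`. -/
lemma exists_combination_monic {k : Type*} [Field k] {p : ℕ} [CharP k p]
    {m n i : ℕ} (him : i < m) (hmn : m ≤ n) (hp : p = 0 ∨ m + n - 2 < p) :
    ∃ a b : k[X], a.natDegree ≤ n - 1 - i ∧ b.natDegree ≤ m - 1 - i ∧
      (X ^ m * a + (1 - X) ^ n * b).coeff i = 1 ∧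
      (X ^ m * a + (1 - X) ^ n * b).natDegree ≤ i := by
  have hdeg : (1 - X : k[X]).natDegree = 1 := by
    rw [← neg_sub, natDegree_neg]
    exact natDegree_X_sub_C (1 : k)
  have hne : (1 - X : k[X]) ≠ 0 := by
    intro h
    simp [h] at hdeg
  have hlt : ∀ {N : ℕ} (q : degreeLT k (N + 1)), (q : k[X]).natDegree ≤ N := fun {N} q =>
    natDegree_le_iff_coeff_eq_zero.2 fun j hj => coeff_eq_zero_of_degree_lt
      ((mem_degreeLT.1 q.2).trans_le (by exact_mod_cast hj))
  have hbound : ∀ a b : k[X], a.natDegree ≤ n - 1 - i → b.natDegree ≤ m - 1 - i →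
      (X ^ m * a).natDegree ≤ m + n - 1 - i ∧ ((1 - X) ^ n * b).natDegree ≤ m + n - 1 - i := by
    intro a b ha hb
    have h1 := natDegree_mul_le (p := (X : k[X]) ^ m) (q := a)
    have h2 := natDegree_mul_le (p := (1 - X : k[X]) ^ n) (q := b)
    rw [natDegree_pow, natDegree_X] at h1
    rw [natDegree_pow, hdeg] at h2
    omega
  let Ψ : (degreeLT k (n - 1 - i + 1) × degreeLT k (m - 1 - i + 1)) →ₗ[k]
      (Fin (m + n - 2 * i) → k) :=
    LinearMap.pi (fun j => lcoeff k (i + j)) ∘ₗ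
      ((LinearMap.mulLeft k (X ^ m) ∘ₗ Submodule.subtype _).coprod
        (LinearMap.mulLeft k ((1 - X) ^ n) ∘ₗ Submodule.subtype _))
  have hΨ : ∀ a b j, Ψ (a, b) j = (X ^ m * (a : k[X]) + (1 - X) ^ n * (b : k[X])).coeff (i + j) := by
    intro a b j
    simp [Ψ]
  have hcoeff : ∀ a b : k[X], a.natDegree ≤ n - 1 - i → b.natDegree ≤ m - 1 - i →
      ∀ j, m + n - i ≤ j → (X ^ m * a + (1 - X) ^ n * b).coeff j = 0 := by
    intro a b ha hb j hj
    obtain ⟨h1, h2⟩ := hbound a b ha hb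
    exact coeff_eq_zero_of_natDegree_lt ((natDegree_add_le_of_degree_le h1 h2).trans_lt (by omega))
  have hinj : Function.Injective Ψ := by
    rw [injective_iff_map_eq_zero]
    rintro ⟨a, b⟩ hab
    obtain ⟨h1, h2⟩ := hbound a b (hlt a) (hlt b)
    have hsum : ∀ j, i ≤ j → (X ^ m * (a : k[X]) + (1 - X) ^ n * (b : k[X])).coeff j = 0 := by
      intro j hj
      by_cases hj' : m + n - i ≤ j
      · exact hcoeff _ _ (hlt a) (hlt b) j hj'
      · have h := congrFun hab ⟨j - i, by omega⟩
        rw [hΨ] at h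
        simpa [Nat.add_sub_cancel' hj] using h
    have hA : ∀ j, i ≤ j → (X ^ m * (a : k[X])).coeff j = 0 := fun j hj =>
      coeff_eq_zero_of_add_coeff_eq_zero him hmn hp (dvd_mul_right _ _) (dvd_mul_right _ _)
        h1 hsum hj
    have ha : (a : k[X]) = 0 := by
      ext j
      have := hA (j + m) (by omega)
      rwa [coeff_X_pow_mul] at this
    have hb : (b : k[X]) = 0 := by
      by_contra hb
      have h3 : ((1 - X) ^ n * (b : k[X])).natDegree = n + (b : k[X]).natDegree := by
        rw [natDegree_mul (pow_ne_zero _ hne) hb, natDegree_pow, hdeg, mul_one]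
      have h4 := hsum ((1 - X) ^ n * (b : k[X])).natDegree (by omega)
      rw [ha, mul_zero, zero_add, coeff_natDegree, leadingCoeff_eq_zero] at h4
      exact mul_ne_zero (pow_ne_zero _ hne) hb h4
    ext1
    · exact Subtype.ext ha
    · exact Subtype.ext hb
  have : Module.Finite k (degreeLT k (n - 1 - i + 1)) :=
    Module.Finite.equiv (degreeLTEquiv k _).symm
  have : Module.Finite k (degreeLT k (m - 1 - i + 1)) :=
    Module.Finite.equiv (degreeLTEquiv k _).symm
  have hrank : Module.finrank k (degreeLT k (n - 1 - i + 1) × degreeLT k (m - 1 - i + 1)) =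
      Module.finrank k (Fin (m + n - 2 * i) → k) := by
    rw [Module.finrank_prod, (degreeLTEquiv k _).finrank_eq, (degreeLTEquiv k _).finrank_eq]
    simp only [Module.finrank_fin_fun]
    omega
  obtain ⟨⟨a, b⟩, hab⟩ := (LinearMap.injective_iff_surjective_of_finrank_eq_finrank hrank).1 hinj
    (Pi.single ⟨0, by omega⟩ 1)
  refine ⟨a, b, hlt a, hlt b, ?_, ?_⟩
  · have h := congrFun hab ⟨0, by omega⟩
    rw [hΨ] at h
    simpa using h
  · rw [natDegree_le_iff_coeff_eq_zero]
    intro j hj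
    by_cases hj' : m + n - i ≤ j
    · exact hcoeff _ _ (hlt a) (hlt b) j hj'
    · have h := congrFun hab ⟨j - i, by omega⟩
      rw [hΨ, Pi.single_eq_of_ne (by simp [Fin.ext_iff]; omega)] at h
      simpa [Nat.add_sub_cancel' hj.le] using h

section Homogenization

variable {k A : Type*} [Field k] [CommRing A] [Algebra k A]

/-- The degree `e` homogenization of a polynomial, evaluated at `(x, t)`. -/
noncomputable def homogEval (x t : A) (e : ℕ) : k[X] →ₗ[k] A :=
  ∑ j ∈ Finset.range (e + 1), (lcoeff k j).smulRight (x ^ j * t ^ (e - j))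

lemma homogEval_apply (x t : A) (e : ℕ) (f : k[X]) :
    homogEval x t e f = ∑ j ∈ Finset.range (e + 1), f.coeff j • (x ^ j * t ^ (e - j)) := by
  simp [homogEval]

lemma homogEval_succ (x t : A) {e : ℕ} {f : k[X]} (hf : f.natDegree ≤ e) :
    homogEval x t (e + 1) f = t * homogEval x t e f := by
  rw [homogEval_apply, homogEval_apply, Finset.sum_range_succ,
    coeff_eq_zero_of_natDegree_lt (by omega), zero_smul, add_zero, Finset.mul_sum]
  refine Finset.sum_congr rfl fun j hj => ?_
  rw [Finset.mem_range] at hj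
  rw [Nat.sub_add_comm (by omega), pow_succ, mul_smul_comm]
  ring_nf

lemma homogEval_add (x t : A) {e : ℕ} (s : ℕ) {f : k[X]} (hf : f.natDegree ≤ e) :
    homogEval x t (e + s) f = t ^ s * homogEval x t e f := by
  induction s with
  | zero => simp
  | succ s ih => rw [← add_assoc, homogEval_succ x t (by omega), ih, pow_succ', mul_assoc]

lemma homogEval_X_mul (x t : A) (e : ℕ) (f : k[X]) :
    homogEval x t (e + 1) (X * f) = x * homogEval x t e f := by
  rw [homogEval_apply, homogEval_apply, Finset.sum_range_succ', Finset.mul_sum]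
  simp only [coeff_X_mul, coeff_X_mul_zero, zero_smul, add_zero]
  refine Finset.sum_congr rfl fun j _ => ?_
  rw [Nat.add_sub_add_right, pow_succ, mul_smul_comm]
  ring_nf

lemma homogEval_X_pow_mul (x t : A) (e m : ℕ) (f : k[X]) :
    homogEval x t (e + m) (X ^ m * f) = x ^ m * homogEval x t e f := by
  induction m with
  | zero => simp
  | succ m ih => rw [← add_assoc, pow_succ', mul_assoc, homogEval_X_mul, ih, pow_succ', mul_assoc]

lemma homogEval_one_sub_X_pow_mul (x t : A) {e : ℕ} (n : ℕ) {f : k[X]} (hf : f.natDegree ≤ e) :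
    homogEval x t (e + n) ((1 - X) ^ n * f) = (t - x) ^ n * homogEval x t e f := by
  induction n with
  | zero => simp
  | succ n ih =>
    have hd : ((1 - X) ^ n * f).natDegree ≤ e + n := by
      have h1 : (1 - X : k[X]).natDegree ≤ 1 := by
        rw [← neg_sub, natDegree_neg]
        exact (natDegree_X_sub_C (1 : k)).le
      have h2 := natDegree_mul_le (p := (1 - X : k[X]) ^ n) (q := f)
      have h3 := natDegree_pow_le_of_le n h1
      omega
    rw [← add_assoc, pow_succ', mul_assoc, sub_mul, one_mul, map_sub, homogEval_X_mul,
      homogEval_succ x t hd, ih, pow_succ']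
    ring

lemma dvd_homogEval_sub (x t : A) (e : ℕ) (f : k[X]) :
    t ∣ homogEval x t e f - f.coeff e • x ^ e := by
  rw [homogEval_apply, Finset.sum_range_succ, Nat.sub_self, pow_zero, mul_one, add_sub_cancel_right]
  refine Finset.dvd_sum fun j hj => ?_
  rw [Finset.mem_range] at hj
  exact dvd_smul_of_dvd _ (Dvd.dvd.mul_left (dvd_pow_self t (by omega)) _)

/-- A vector congruent to `x ^ i` modulo `x + y` and killed by `(x + y) ^ (m + n - 1 - 2 * i)`. -/
lemma exists_block_generator {p : ℕ} [CharP k p] {m n i : ℕ} (him : i < m) (hmn : m ≤ n)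
    (hp : p = 0 ∨ m + n - 2 < p) {x y : A} (hx : x ^ m = 0) (hy : y ^ n = 0) :
    ∃ v : A, (x + y) ^ (m + n - 1 - 2 * i) * v = 0 ∧ (x + y) ∣ v - x ^ i := by
  obtain ⟨a, b, ha, hb, hi, hd⟩ := exists_combination_monic (k := k) him hmn hp
  refine ⟨homogEval x (x + y) i (X ^ m * a + (1 - X) ^ n * b), ?_, ?_⟩
  · rw [← homogEval_add x (x + y) _ hd, map_add]
    have h1 : i + (m + n - 1 - 2 * i) = n - 1 - i + m := by omega
    have h2 : n - 1 - i + m = m - 1 - i + n := by omega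
    rw [h1, homogEval_X_pow_mul, h2, homogEval_one_sub_X_pow_mul _ _ _ hb]
    simp [hx, hy]
  · have h := dvd_homogEval_sub x (x + y) i (X ^ m * a + (1 - X) ^ n * b)
    rwa [hi, one_smul] at h

end Homogenization

/-- If `x` and `y` generate `R` and `S`, then modulo `x ⊗ 1 + 1 ⊗ y` every element of `R ⊗ S` is
a polynomial in `x ⊗ 1`. -/
lemma exists_dvd_sub_aeval_tmul {k R S : Type*} [Field k] [CommRing R] [Algebra k R] [CommRing S]
    [Algebra k S] {x : R} {y : S} (hR : ∀ a, ∃ q : k[X], aeval x q = a)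
    (hS : ∀ b, ∃ q : k[X], aeval y q = b) (a : R ⊗[k] S) :
    ∃ q : k[X], (x ⊗ₜ[k] (1 : S) + (1 : R) ⊗ₜ[k] y) ∣ a - aeval (x ⊗ₜ[k] (1 : S)) q := by
  induction a with
  | zero => exact ⟨0, by simp⟩
  | add a b ha hb =>
    obtain ⟨q, hq⟩ := ha
    obtain ⟨r, hr⟩ := hb
    refine ⟨q + r, ?_⟩
    rw [map_add, add_sub_add_comm]
    exact dvd_add hq hr
  | tmul a b =>
    obtain ⟨q, rfl⟩ := hR a
    obtain ⟨r, rfl⟩ := hS b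
    have hq : aeval x q ⊗ₜ[k] (1 : S) = aeval (x ⊗ₜ[k] (1 : S)) q :=
      (aeval_algHom_apply (Algebra.TensorProduct.includeLeft : R →ₐ[k] R ⊗[k] S) x q).symm
    have hr : (1 : R) ⊗ₜ[k] aeval y r = aeval ((1 : R) ⊗ₜ[k] y) r :=
      (aeval_algHom_apply (Algebra.TensorProduct.includeRight : S →ₐ[k] R ⊗[k] S) y r).symm
    have htmul : aeval x q ⊗ₜ[k] aeval y r =
        aeval (x ⊗ₜ[k] (1 : S)) q * aeval ((1 : R) ⊗ₜ[k] y) r := by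
      rw [← hq, ← hr, Algebra.TensorProduct.tmul_mul_tmul, one_mul, mul_one]
    refine ⟨q * r.comp (-X), ?_⟩
    rw [htmul, map_mul, aeval_comp, ← mul_sub]
    have h := sub_dvd_eval_sub ((1 : R) ⊗ₜ[k] y) (-(x ⊗ₜ[k] (1 : S)))
      (r.map (algebraMap k (R ⊗[k] S)))
    rw [eval_map_algebraMap, eval_map_algebraMap, sub_neg_eq_add,
      add_comm ((1 : R) ⊗ₜ[k] y)] at h
    rw [map_neg, aeval_X]
    exact h.mul_left _

/-- A version of Nakayama's lemma for multiplication by a nilpotent element. -/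
lemma Submodule.eq_top_of_add_smul_of_nilpotent {R M : Type*} [CommRing R] [AddCommGroup M] [Module R M]
    (N : Submodule R M) (t : R) (K : ℕ) (hK : ∀ a : M, t ^ K • a = 0)
    (h : ∀ a : M, ∃ w ∈ N, ∃ u, a = w + t • u) : N = ⊤ := by
  have key : ∀ s : ℕ, ∀ a : M, ∃ w ∈ N, ∃ u, a = w + t ^ s • u := by
    intro s
    induction s with
    | zero => exact fun a => ⟨0, N.zero_mem, a, by simp⟩
    | succ s ih =>
      intro a
      obtain ⟨w, hw, u, rfl⟩ := ih a
      obtain ⟨w', hw', u', rfl⟩ := h u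
      refine ⟨w + t ^ s • w', N.add_mem hw (N.smul_mem _ hw'), u', ?_⟩
      rw [smul_add, smul_smul, ← pow_succ, add_assoc]
  rw [eq_top_iff]
  intro a _
  obtain ⟨w, hw, u, rfl⟩ := key K a
  rwa [hK, add_zero]

lemma sum_block_sizes {m n : ℕ} (hmn : m ≤ n) :
    ∑ i : Fin m, (m + n - 1 - 2 * (i : ℕ)) = m * n := by
  rw [Fin.sum_univ_eq_sum_range (fun i => m + n - 1 - 2 * i)]
  have h : ∀ r ≤ m, ∑ i ∈ Finset.range r, (m + n - 1 - 2 * i) = r * (m + n - r) := by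
    intro r hr
    induction r with
    | zero => simp
    | succ r ih =>
      rw [Finset.sum_range_succ, ih (by omega)]
      obtain ⟨c, hc⟩ : ∃ c, m + n = 2 * r + 1 + c := ⟨m + n - (2 * r + 1), by omega⟩
      rw [hc, show 2 * r + 1 + c - r = r + 1 + c by omega,
        show 2 * r + 1 + c - 1 - 2 * r = c by omega,
        show 2 * r + 1 + c - (r + 1) = r + c by omega]
      ring
  rw [h m le_rfl, Nat.add_sub_cancel_left]

lemma finrank_Mq (k : Type) [Field k] (n : ℕ) : Module.finrank k (Mq k n) = n := by
  rw [finrank_quotient_span_eq_natDegree, natDegree_X_pow]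

instance finite_Mq (k : Type) [Field k] (n : ℕ) : Module.Finite k (Mq k n) :=
  .of_basis (AdjoinRoot.powerBasis' (monic_X_pow n)).basis

/-- A `k[X]`-module on which `X` acts as multiplication by `x + y` on a `k`-algebra of dimension
`m * n`, where `x ^ m = y ^ n = 0` and `x` generates the algebra modulo `x + y`. -/
lemma nonempty_equiv_pi_of_mul_add {k : Type} [Field k] {p : ℕ} [CharP k p] {m n : ℕ}
    (hmn : m ≤ n) (hp : p = 0 ∨ m + n - 2 < p) {A M : Type*} [CommRing A] [Algebra k A]
    [AddCommGroup M] [Module k M] [Module.Finite k M] {x y : A} (hx : x ^ m = 0) (hy : y ^ n = 0)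
    (hgen : ∀ a, ∃ q : k[X], (x + y) ∣ a - aeval x q) {T : Module.End k M} (φ : A ≃ₗ[k] M)
    (hT : ∀ a, T (φ a) = φ ((x + y) * a)) (hrank : Module.finrank k M = m * n) :
    Nonempty (Module.AEval' T ≃ₗ[k[X]] ((i : Fin m) → Mq k (m + n - 1 - 2 * (i : ℕ)))) := by
  classical
  let ψ : A ≃ₗ[k] Module.AEval' T := φ.trans (Module.AEval'.of T)
  have hX : ∀ a, (X : k[X]) • ψ a = ψ ((x + y) * a) := by
    intro a
    rw [LinearEquiv.trans_apply, Module.AEval'.X_smul_of, hT, LinearEquiv.trans_apply]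
  have hXpow : ∀ (s : ℕ) a, (X : k[X]) ^ s • ψ a = ψ ((x + y) ^ s * a) := by
    intro s
    induction s with
    | zero => simp
    | succ s ih =>
      intro a
      rw [pow_succ, mul_smul, hX, ih, pow_succ, mul_assoc]
  have hnil : (x + y) ^ (m + n) = 0 :=
    (Commute.all x y).add_pow_eq_zero_of_add_le_succ_of_pow_eq_zero hx hy (by omega)
  choose v hv hvx using fun i : Fin m => exists_block_generator (k := k) i.2 hmn hp hx hy
  let Φi : (i : Fin m) → Mq k (m + n - 1 - 2 * (i : ℕ)) →ₗ[k[X]] Module.AEval' T :=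
    fun i => Submodule.liftQ _ (LinearMap.toSpanSingleton k[X] _ (ψ (v i))) (by
      rw [Ideal.span, Submodule.span_singleton_le_iff_mem, LinearMap.mem_ker,
        LinearMap.toSpanSingleton_apply, hXpow, hv, map_zero])
  let Φ := LinearMap.lsum k[X] _ k[X] Φi
  have hmem : ∀ i, ψ (v i) ∈ LinearMap.range Φ := by
    intro i
    refine ⟨Pi.single i (Submodule.Quotient.mk 1), ?_⟩
    rw [LinearMap.lsum_piSingle, Submodule.liftQ_apply, LinearMap.toSpanSingleton_apply, one_smul]
  have hpoly : ∀ q : k[X], ∃ w ∈ LinearMap.range Φ, ∃ u, ψ (aeval x q) = w + (X : k[X]) • u := by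
    intro q
    induction q using Polynomial.induction_on' with
    | add q r hq hr =>
      obtain ⟨w, hw, u, hu⟩ := hq
      obtain ⟨w', hw', u', hu'⟩ := hr
      refine ⟨w + w', add_mem hw hw', u + u', ?_⟩
      rw [map_add, map_add, hu, hu', smul_add]
      abel
    | monomial j c =>
      rw [aeval_monomial, ← Algebra.smul_def]
      by_cases hj : j < m
      · obtain ⟨u, hu⟩ := hvx ⟨j, hj⟩
        refine ⟨c • ψ (v ⟨j, hj⟩), Submodule.smul_of_tower_mem _ c (hmem _), ψ (-(c • u)), ?_⟩
        rw [hX, ← map_smul, ← map_add, mul_neg, mul_smul_comm, ← hu, smul_sub]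
        congr 1
        abel
      · refine ⟨0, zero_mem _, 0, ?_⟩
        rw [pow_eq_zero_of_le (not_lt.1 hj) hx]
        simp
  have hsurj : LinearMap.range Φ = ⊤ := by
    refine Submodule.eq_top_of_add_smul_of_nilpotent _ X (m + n) ?_ ?_
    · intro a
      obtain ⟨a, rfl⟩ := ψ.surjective a
      rw [hXpow, hnil, zero_mul, map_zero]
    · intro a
      obtain ⟨a, rfl⟩ := ψ.surjective a
      obtain ⟨q, u, hu⟩ := hgen a
      obtain ⟨w, hw, u', hu'⟩ := hpoly q
      refine ⟨w, hw, u' + ψ u, ?_⟩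
      rw [sub_eq_iff_eq_add.1 hu, map_add, ← hX, hu', smul_add]
      abel
  have hrank' : Module.finrank k ((i : Fin m) → Mq k (m + n - 1 - 2 * (i : ℕ))) =
      Module.finrank k (Module.AEval' T) := by
    rw [← (Module.AEval'.of T).finrank_eq, hrank, Module.finrank_pi_fintype]
    simp only [finrank_Mq]
    exact sum_block_sizes hmn
  have : Module.Finite k (Module.AEval' T) := Module.Finite.equiv (Module.AEval'.of T)
  have hs : Function.Surjective Φ := LinearMap.range_eq_top.1 hsurj
  have hi := (LinearMap.injective_iff_surjective_of_finrank_eq_finrank hrank'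
    (f := Φ.restrictScalars k)).2 hs
  exact ⟨(LinearEquiv.ofBijective Φ ⟨hi, hs⟩).symm⟩

lemma aeval_root_surjective {k : Type*} [Field k] (f : k[X]) (a : AdjoinRoot f) :
    ∃ q : k[X], aeval (AdjoinRoot.root f) q = a := by
  obtain ⟨q, rfl⟩ := AdjoinRoot.mk_surjective a
  exact ⟨q, AdjoinRoot.aeval_eq q⟩

lemma root_X_pow_pow (k : Type*) [Field k] (n : ℕ) :
    AdjoinRoot.root ((X : k[X]) ^ n) ^ n = 0 := by
  rw [← AdjoinRoot.mk_X, ← map_pow, AdjoinRoot.mk_self]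

/-- `Mq k n` as the underlying module of the algebra `AdjoinRoot (X ^ n)`. -/
noncomputable def adjoinRootEquivMq (k : Type) [Field k] (n : ℕ) :
    AdjoinRoot ((X : k[X]) ^ n) ≃ₗ[k] Mq k n where
  toFun a := a
  invFun a := a
  map_add' _ _ := rfl
  map_smul' _ _ := rfl
  left_inv _ := rfl
  right_inv _ := rfl

lemma mulX_adjoinRootEquivMq (k : Type) [Field k] (n : ℕ) (a : AdjoinRoot ((X : k[X]) ^ n)) :
    mulX k n (adjoinRootEquivMq k n a) = adjoinRootEquivMq k n (AdjoinRoot.root _ * a) := by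
  obtain ⟨a, rfl⟩ := AdjoinRoot.mk_surjective a
  rfl

/-- Let `k` have characteristic `p ≥ 0` and `1 ≤ m ≤ n`.  If `p = 0` or `p > m+n-2`, then
`M_m ⊗_k M_n ≅ ∏_{i=0}^{m-1} M_{m+n-1-2i}` as `k[X]`-modules, where `X` acts on the tensor
product as `X⊗1 + 1⊗X`; i.e. the Jordan form of `T_{m,n}` has exactly one block of each of
the sizes `m+n-1, m+n-3, …, n-m+1`. -/
theorem tensor_decomposition_large_char (k : Type) [Field k] (p : ℕ) [CharP k p]
    (m n : ℕ) (hm : 1 ≤ m) (hmn : m ≤ n) (hp : p = 0 ∨ m + n - 2 < p) :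
    Nonempty ((Module.AEval' (tensorX k m n)) ≃ₗ[Polynomial k]
      ((i : Fin m) → Mq k (m + n - 1 - 2 * (i : ℕ)))) := by
  refine nonempty_equiv_pi_of_mul_add hmn hp
    (x := AdjoinRoot.root ((X : k[X]) ^ m) ⊗ₜ[k] (1 : AdjoinRoot ((X : k[X]) ^ n)))
    (y := (1 : AdjoinRoot ((X : k[X]) ^ m)) ⊗ₜ[k] AdjoinRoot.root ((X : k[X]) ^ n)) ?_ ?_
    (exists_dvd_sub_aeval_tmul (aeval_root_surjective _) (aeval_root_surjective _))
    (TensorProduct.congr (adjoinRootEquivMq k m) (adjoinRootEquivMq k n)) ?_ ?_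
  · rw [Algebra.TensorProduct.tmul_pow, root_X_pow_pow, TensorProduct.zero_tmul]
  · rw [Algebra.TensorProduct.tmul_pow, root_X_pow_pow, TensorProduct.tmul_zero]
  · intro a
    induction a with
    | zero => simp
    | add a b ha hb => rw [map_add, map_add, ha, hb, mul_add, map_add]
    | tmul a b =>
      rw [add_mul, Algebra.TensorProduct.tmul_mul_tmul, Algebra.TensorProduct.tmul_mul_tmul,
        one_mul, one_mul, map_add]
      simp [tensorX, mulX_adjoinRootEquivMq]
  · rw [Module.finrank_tensorProduct, finrank_Mq, finrank_Mq]
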